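/- There exist two invertible bounded linear operators S₀ and S₁ on a complex separable infinite-dimensional Hilbert space H such that for every non-zero vector x of H, either the linear span of {S₀^n x : n ≥ 0} or the linear span of {S₁^n x : n ≥ 0} is dense in H. -/

import Mathlib

lemma aux_basis (H : Type) [NormedAddCommGroup H] [InnerProductSpace ℂ H] [CompleteSpace H]
    [TopologicalSpace.SeparableSpace H] (hdim : ¬ FiniteDimensional ℂ H) :
    Nonempty (HilbertBasis ℕ ℂ H) := by
  obtain ⟨w, b, hb⟩ := exists_hilbertBasis ℂ H
  have hinf : Infinite w := by
    by_contra h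
    rw [not_infinite_iff_finite] at h
    haveI := Fintype.ofFinite w
    exact hdim b.toOrthonormalBasis.toBasis.finiteDimensional_of_finite
  have hcount : Countable w := by
    have hd : ∀ i j : w, i ≠ j → 1 ≤ dist (b i) (b j) := by
      intro i j hij
      have h1 : ‖b i - b j‖ ^ 2 = 2 := by
        rw [@norm_sub_sq ℂ, b.orthonormal.2 hij, b.orthonormal.1 i, b.orthonormal.1 j]
        norm_num
      rw [dist_eq_norm]
      nlinarith [norm_nonneg (b i - b j)]
    have := Set.PairwiseDisjoint.countable_of_isOpen (ι := w) (a := Set.univ)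
      (s := fun i => Metric.ball (b i) (1/2)) ?_ (fun i _ => Metric.isOpen_ball)
      (fun i _ => ⟨b i, Metric.mem_ball_self (by norm_num)⟩)
    · exact Set.countable_univ_iff.mp this
    · intro i _ j _ hij
      apply Metric.ball_disjoint_ball
      have := hd i j hij
      linarith
  obtain ⟨e⟩ := nonempty_equiv_of_countable (α := ℕ) (β := w)
  refine ⟨HilbertBasis.mk (v := b ∘ e) (b.orthonormal.comp e e.injective) ?_⟩
  rw [e.surjective.range_comp, b.dense_span]

lemma aux_op {H : Type} [NormedAddCommGroup H] [InnerProductSpace ℂ H] [CompleteSpace H]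
    (b : HilbertBasis ℕ ℂ H) (f : ℕ → ℕ) :
    ∃ A : H →L[ℂ] H, ‖A‖ < 1 ∧
      ∀ x k, inner ℂ (b k) (A x) = ((1/4 : ℂ) * (1/2) ^ k) * inner ℂ (b (f k)) x := by
  let g : ℕ → (H →L[ℂ] H) := fun k =>
    ((1/4 : ℂ) * (1/2) ^ k) • (innerSL ℂ (b (f k))).smulRight (b k)
  have hg : ∀ k, ‖g k‖ ≤ 1/4 * (1/2 : ℝ) ^ k := by
    intro k
    simp only [g, norm_smul, ContinuousLinearMap.norm_smulRight_apply, innerSL_apply_norm,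
      b.orthonormal.1]
    simp
  have hs : HasSum (fun k : ℕ => 1/4 * (1/2 : ℝ) ^ k) (1/4 * 2) := hasSum_geometric_two.mul_left _
  have hsum : Summable g := Summable.of_norm_bounded hs.summable hg
  refine ⟨∑' k, g k, lt_of_le_of_lt (tsum_of_norm_bounded hs hg) (by norm_num), ?_⟩
  intro x k
  have h1 := (hsum.hasSum.mapL (ContinuousLinearMap.apply ℂ H x)).mapL (innerSL ℂ (b k))
  have h2 := h1.unique (hasSum_single k ?_)
  · simpa [g, inner_smul_right, b.orthonormal.1] using h2
  · intro j hj
    simp [g, inner_smul_right, b.orthonormal.2 hj.symm]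

lemma aux_peak (u : ℕ → ℝ) (hu : Filter.Tendsto u Filter.atTop (nhds 0))
    (h0 : ∀ N, ∃ n ≥ N, 0 < u n) (N : ℕ) :
    ∃ n ≥ N, 0 < u n ∧ ∀ k ≥ n, u k ≤ u n := by
  obtain ⟨n0, hn0, hpos⟩ := h0 N
  obtain ⟨M, hM⟩ := Filter.eventually_atTop.mp (hu.eventually (gt_mem_nhds hpos))
  have hlt : n0 < M := by
    by_contra h
    exact lt_irrefl _ (hM n0 (not_lt.mp h))
  obtain ⟨n, hn, hmax⟩ := Finset.exists_max_image (Finset.Ico N M) u ⟨n0, by simp [hn0, hlt]⟩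
  rw [Finset.mem_Ico] at hn
  have hle := hmax n0 (by simp [hlt]; exact hn0)
  refine ⟨n, hn.1, by linarith, fun k hk => ?_⟩
  by_cases hkM : k < M
  · exact hmax k (Finset.mem_Ico.mpr ⟨by omega, hkM⟩)
  · linarith [hM k (not_lt.mp hkM)]

lemma aux_pow {H : Type} [NormedAddCommGroup H] [InnerProductSpace ℂ H] [CompleteSpace H]
    (b : HilbertBasis ℕ ℂ H) (A : H →L[ℂ] H)
    (hA : ∀ x k, inner ℂ (b k) (A x) = ((1/4 : ℂ) * (1/2) ^ k) * inner ℂ (b (k+1)) x) (m : ℕ) :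
    ∃ c : ℂ, c ≠ 0 ∧ ∀ x j, inner ℂ (b j) ((A ^ m) x) =
      c * ((1/2) ^ (m * j) * inner ℂ (b (j + m)) x) := by
  induction m with
  | zero => exact ⟨1, one_ne_zero, by simp⟩
  | succ m ih =>
    obtain ⟨c, hc, h⟩ := ih
    refine ⟨c * (1/4) * (1/2)^m, by simp [hc], fun x j => ?_⟩
    rw [pow_succ', ContinuousLinearMap.mul_apply, hA, h]
    rw [show j + 1 + m = j + (m + 1) by ring]
    ring

lemma aux_orth {H : Type} [NormedAddCommGroup H] [InnerProductSpace ℂ H] [CompleteSpace H]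
    (b : HilbertBasis ℕ ℂ H) (A : H →L[ℂ] H)
    (hA : ∀ x k, inner ℂ (b k) (A x) = ((1/4 : ℂ) * (1/2) ^ k) * inner ℂ (b (k+1)) x)
    (x : H) (hx : ∀ N, ∃ n ≥ N, inner ℂ (b n) x ≠ 0) (y : H)
    (hy : ∀ m, inner ℂ y ((A ^ m) x) = 0) : y = 0 := by
  by_contra hy0
  have hex : ∃ r, inner ℂ y (b r) ≠ 0 := by
    by_contra hcon
    push Not at hcon
    have h := b.hasSum_inner_mul_inner y y
    simp only [hcon, zero_mul] at h
    exact hy0 (inner_self_eq_zero.mp (h.unique hasSum_zero))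
  classical
  set r := Nat.find hex with hr
  have hrne : inner ℂ y (b r) ≠ 0 := Nat.find_spec hex
  have hrmin : ∀ j < r, inner ℂ y (b j) = 0 := fun j hj => by
    by_contra h
    exact Nat.find_min hex hj h
  have htend : Filter.Tendsto (fun n => ‖inner ℂ (b n) x‖) Filter.atTop (nhds 0) := by
    have h := (b.orthonormal.inner_products_summable x).tendsto_atTop_zero
    have h2 := h.sqrt
    simpa using h2
  have key : ∀ N : ℕ, ‖inner ℂ y (b r)‖ ≤ ‖y‖ * 2 * (1/2 : ℝ) ^ N := by
    intro N
    obtain ⟨n, hn, hpos, hmax⟩ := aux_peak _ htend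
      (fun N => by simpa using hx N) (N + r + 1)
    obtain ⟨m, rfl⟩ : ∃ m, n = r + m := ⟨n - r, by omega⟩
    have hm : N + 1 ≤ m := by omega
    obtain ⟨c, hc, hcx⟩ := aux_pow b A hA m
    have h := b.hasSum_inner_mul_inner y ((A ^ m) x)
    rw [hy m] at h
    have h' := h.mul_left c⁻¹
    set t : ℕ → ℂ := fun j => inner ℂ y (b j) * ((1/2) ^ (m * j) * inner ℂ (b (j + m)) x) with ht
    have h2 : HasSum t 0 := by
      have e : t = fun i => c⁻¹ * (inner ℂ y (b i) * inner ℂ (b i) ((A ^ m) x)) := by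
        funext j
        simp only [ht, hcx]
        field_simp
      rw [mul_zero] at h'
      rw [e]
      exact h'
    have h3 : HasSum (fun i => t (i + (r + 1))) (- t r) := by
      rw [hasSum_nat_add_iff (f := t) (r + 1)]
      rw [Finset.sum_range_succ, Finset.sum_eq_zero]
      · simpa using h2
      · intro j hj
        simp [ht, hrmin j (Finset.mem_range.mp hj)]
    set X := ‖inner ℂ (b (r + m)) x‖ with hX
    have hb : ∀ i, ‖t (i + (r + 1))‖ ≤
        (‖y‖ * X * (1/2) ^ (m * r) * (1/2) ^ N) * (1/2 : ℝ) ^ i := by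
      intro i
      have e1 : ‖inner ℂ y (b (i + (r + 1)))‖ ≤ ‖y‖ := by
        have := norm_inner_le_norm (𝕜 := ℂ) y (b (i + (r + 1)))
        rwa [b.orthonormal.1, mul_one] at this
      have e2 : ‖inner ℂ (b (i + (r + 1) + m)) x‖ ≤ X := hmax _ (by omega)
      have e3 : (1/2 : ℝ) ^ (m * (i + (r + 1))) ≤ (1/2) ^ (m * r) * (1/2) ^ N * (1/2 : ℝ) ^ i := by
        rw [← pow_add, ← pow_add]
        apply pow_le_pow_of_le_one (by norm_num) (by norm_num)
        nlinarith [Nat.zero_le i]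
      have e4 : ‖t (i + (r + 1))‖ = ‖inner ℂ y (b (i + (r + 1)))‖ *
          ((1/2 : ℝ) ^ (m * (i + (r + 1))) * ‖inner ℂ (b (i + (r + 1) + m)) x‖) := by
        simp [ht]
      rw [e4]
      calc _ ≤ ‖y‖ * (((1/2) ^ (m * r) * (1/2) ^ N * (1/2 : ℝ) ^ i) * X) := by gcongr
        _ = _ := by ring
    have h4 := tsum_of_norm_bounded (hasSum_geometric_two.mul_left _) hb
    rw [h3.tsum_eq, norm_neg] at h4
    have e5 : ‖t r‖ = ‖inner ℂ y (b r)‖ * ((1/2 : ℝ) ^ (m * r) * X) := by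
      simp [ht, hX]
    rw [e5] at h4
    have hp : 0 < (1/2 : ℝ) ^ (m * r) * X := by positivity
    refine le_of_mul_le_mul_right (h4.trans (le_of_eq ?_)) hp
    ring
  have hlim : Filter.Tendsto (fun N : ℕ => ‖y‖ * 2 * (1/2 : ℝ) ^ N) Filter.atTop (nhds 0) := by
    simpa using (tendsto_pow_atTop_nhds_zero_of_lt_one (r := (1/2 : ℝ))
      (by norm_num) (by norm_num)).const_mul (‖y‖ * 2)
  have := ge_of_tendsto' hlim key
  exact hrne (norm_le_zero_iff.mp this)

lemma aux_cyc {H : Type} [NormedAddCommGroup H] [InnerProductSpace ℂ H] [CompleteSpace H]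
    (b : HilbertBasis ℕ ℂ H) (A : H →L[ℂ] H)
    (hA : ∀ x k, inner ℂ (b k) (A x) = ((1/4 : ℂ) * (1/2) ^ k) * inner ℂ (b (k+1)) x)
    (x : H) (hx : ∀ N, ∃ n ≥ N, inner ℂ (b n) x ≠ 0) :
    Dense (Submodule.span ℂ (Set.range fun n : ℕ => ((1 - A) ^ n) x) : Set H) := by
  rw [Submodule.dense_iff_topologicalClosure_eq_top, Submodule.topologicalClosure_eq_top_iff,
    Submodule.eq_bot_iff]
  intro y hy
  set K := Submodule.span ℂ (Set.range fun n : ℕ => ((1 - A) ^ n) x) with hK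
  have hS : ∀ z ∈ K, (1 - A) z ∈ K := by
    intro z hz
    have : K ≤ K.comap ((1 - A : H →L[ℂ] H) : H →ₗ[ℂ] H) := by
      rw [hK, Submodule.span_le]
      rintro _ ⟨n, rfl⟩
      refine Submodule.subset_span ⟨n + 1, ?_⟩
      simp only [pow_succ']
      rfl
    exact this hz
  have hT : ∀ m, (A ^ m) x ∈ K := by
    intro m
    induction m with
    | zero => exact Submodule.subset_span ⟨0, by simp⟩
    | succ m ih =>
      have h := K.sub_mem ih (hS _ ih)
      rw [pow_succ', ContinuousLinearMap.mul_apply]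
      simpa using h
  exact aux_orth b A hA x hx y fun m => (Submodule.mem_orthogonal' K y).mp hy _ (hT m)

/-- There exist two invertible bounded linear operators `S₀`, `S₁` on a complex separable
infinite-dimensional Hilbert space `H` such that for every non-zero `x ∈ H`, the linear span of
the orbit of `x` under `S₀` or under `S₁` is dense in `H`. -/
theorem stmt_2 (H : Type) [NormedAddCommGroup H] [InnerProductSpace ℂ H] [CompleteSpace H]
    [TopologicalSpace.SeparableSpace H] (hdim : ¬ FiniteDimensional ℂ H) :
    ∃ S₀ S₁ : H →L[ℂ] H, IsUnit S₀ ∧ IsUnit S₁ ∧ ∀ x : H, x ≠ 0 →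
      Dense (Submodule.span ℂ (Set.range fun n : ℕ => (S₀ ^ n) x) : Set H) ∨
      Dense (Submodule.span ℂ (Set.range fun n : ℕ => (S₁ ^ n) x) : Set H) := by
  obtain ⟨b⟩ := aux_basis H hdim
  obtain ⟨A, hA1, hA⟩ := aux_op b (fun k => k + 1)
  obtain ⟨V, hV1, hV⟩ := aux_op b (fun k => (Nat.unpair k).1)
  obtain ⟨U, hU⟩ := isUnit_one_sub_of_norm_lt_one hV1
  have hSA := isUnit_one_sub_of_norm_lt_one hA1
  refine ⟨1 - A, U * (1 - A) * ↑U⁻¹, hSA, (U.isUnit.mul hSA).mul (U⁻¹).isUnit, fun x hx => ?_⟩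
  by_cases h1 : ∀ N, ∃ n ≥ N, inner ℂ (b n) x ≠ 0
  · exact Or.inl (aux_cyc b A hA x h1)
  right
  set y : H := (↑U⁻¹ : H →L[ℂ] H) x with hy
  have hUy : (U : H →L[ℂ] H) y = x := by
    rw [hy, ← ContinuousLinearMap.mul_apply, Units.mul_inv]; rfl
  have hy0 : y ≠ 0 := by
    intro h
    rw [h, map_zero] at hUy
    exact hx hUy.symm
  by_cases h2 : ∀ N, ∃ n ≥ N, inner ℂ (b n) y ≠ 0
  · have hd := aux_cyc b A hA y h2
    have hsurj : Function.Surjective (U : H →L[ℂ] H) := fun z =>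
      ⟨(↑U⁻¹ : H →L[ℂ] H) z, by rw [← ContinuousLinearMap.mul_apply, Units.mul_inv]; rfl⟩
    have hd2 := hsurj.denseRange.dense_image (U : H →L[ℂ] H).continuous hd
    refine hd2.mono ?_
    rintro _ ⟨z, hz, rfl⟩
    have hle : Submodule.span ℂ (Set.range fun n : ℕ => ((1 - A) ^ n) y) ≤
        (Submodule.span ℂ (Set.range fun n : ℕ =>
          (((U : H →L[ℂ] H) * (1 - A) * ↑U⁻¹) ^ n) x)).comap
          ((U : H →L[ℂ] H) : H →ₗ[ℂ] H) := by
      rw [Submodule.span_le]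
      rintro _ ⟨n, rfl⟩
      refine Submodule.subset_span ⟨n, ?_⟩
      simp only [Units.conj_pow]
      rfl
    exact hle hz
  · exfalso
    push Not at h1 h2
    obtain ⟨N1, h1⟩ := h1
    obtain ⟨N2, h2⟩ := h2
    apply hy0
    have hz : ∀ k, inner ℂ (b k) y = 0 := by
      intro k
      set p := Nat.pair k (max N1 N2) with hp
      have hpge : max N1 N2 ≤ p := Nat.right_le_pair _ _
      have e1 := h1 p (le_trans (le_max_left _ _) hpge)
      have e2 := h2 p (le_trans (le_max_right _ _) hpge)
      rw [← hUy, hU, ContinuousLinearMap.sub_apply, inner_sub_right, hV,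
        ContinuousLinearMap.one_apply, e2] at e1
      simpa [hp] using e1
    have h := b.hasSum_inner_mul_inner y y
    simp only [hz, mul_zero] at h
    exact inner_self_eq_zero.mp (h.unique hasSum_zero)
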